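/- arXiv:math/0309364 — 2 statements merged into one kernel-verified Lean document; each statement's English description precedes it below -/
import Mathlib

section
/- If (ρ,K) is a minimal AY pair for the Coxeter system (W,S), then for every s ∈ S and w ∈ K with ws ∈ K, the coefficient b_s(w) is nonzero. -/
open CoxeterSystem

variable {B W : Type*} [Group W] {M : CoxeterMatrix B}

/-- The basis vector `C_w` of the vector space `V_K` spanned by `{C_w : w ∈ K}`,
realized as finitely supported functions on the subtype `K`. -/
noncomputable def Cvec (F : Type*) [Field F] (K : Set W) (w : W) (hw : w ∈ K) : ↥K →₀ F :=
  Finsupp.single ⟨w, hw⟩ 1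

/-- An abstract Young (AY) pair: a representation `ρ` of `W` on `V_K` together with
coefficients `a, b` satisfying Axiom (A). -/
structure AYPair (cs : CoxeterSystem M W) (F : Type*) [Field F] (K : Set W) where
  ρ : Representation F W (↥K →₀ F)
  a : B → W → F
  b : B → W → F
  axiomA_mem : ∀ (i : B) (w : W) (hw : w ∈ K) (h : w * cs.simple i ∈ K),
    ρ (cs.simple i) (Cvec F K w hw) =
      a i w • Cvec F K w hw + b i w • Cvec F K (w * cs.simple i) h
  axiomA_not_mem : ∀ (i : B) (w : W) (hw : w ∈ K), w * cs.simple i ∉ K →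
    ρ (cs.simple i) (Cvec F K w hw) = a i w • Cvec F K w hw
  b_eq_zero : ∀ (i : B) (w : W), w ∈ K → w * cs.simple i ∉ K → b i w = 0

/-- A path in the right Cayley graph starting at `v`, given by a list of generators `l`,
is `ρ`-feasible if all its arcs are `ρ`-feasible: both endpoints of each arc
lie in `K` and the corresponding `b`-coefficient is nonzero. -/
def FeasiblePath {cs : CoxeterSystem M W} {F : Type*} [Field F] {K : Set W}
    (P : AYPair cs F K) (v : W) (l : List B) : Prop :=
  ∀ (n : ℕ) (hn : n < l.length),
    v * cs.wordProd (l.take n) ∈ K ∧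
    v * cs.wordProd (l.take (n + 1)) ∈ K ∧
    P.b (l.get ⟨n, hn⟩) (v * cs.wordProd (l.take n)) ≠ 0

/-- The span of `{C_w : w ∈ K'}` inside `V_K`. -/
noncomputable def spanOf (F : Type*) [Field F] (K : Set W) (K' : Set W) :
    Submodule F (↥K →₀ F) :=
  Submodule.span F {x | ∃ (w : W) (h : w ∈ K), w ∈ K' ∧ x = Cvec F K w h}

/-- Minimality of an AY pair: `K` is nonempty and it has no proper nonempty subset `K'`
such that `span{C_w : w ∈ K'}` is `ρ`-invariant. -/
def AYPair.Minimal {cs : CoxeterSystem M W} {F : Type*} [Field F] {K : Set W}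
    (P : AYPair cs F K) : Prop :=
  K.Nonempty ∧ ∀ K' : Set W, K' ⊆ K → K'.Nonempty →
    (∀ (g : W), ∀ x ∈ spanOf F K K', P.ρ g x ∈ spanOf F K K') → K' = K

/-- The coefficient of `C_u` in `x ∈ V_K`, extended by zero to all `u`. -/
noncomputable def coeffAt {α F : Type*} [Field F] {K : Set α} (x : ↥K →₀ F) (u : α) : F :=
  open Classical in if h : u ∈ K then x ⟨u, h⟩ else 0

theorem coeffAt_add {α F : Type*} [Field F] {K : Set α} (x y : ↥K →₀ F) (u : α) :
    coeffAt (x + y) u = coeffAt x u + coeffAt y u := by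
  unfold coeffAt
  split_ifs <;> simp

theorem coeffAt_smul {α F : Type*} [Field F] {K : Set α} (c : F) (x : ↥K →₀ F) (u : α) :
    coeffAt (c • x) u = c * coeffAt x u := by
  unfold coeffAt
  split_ifs <;> simp

theorem coeffAt_Cvec_self {α F : Type*} [Field F] {K : Set α} {w : α} (hw : w ∈ K) :
    coeffAt (Cvec F K w hw) w = 1 := by
  simp [coeffAt, Cvec, hw]

theorem coeffAt_Cvec_of_ne {α F : Type*} [Field F] {K : Set α} {w u : α} (hw : w ∈ K)
    (h : u ≠ w) : coeffAt (Cvec F K w hw) u = 0 := by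
  unfold coeffAt Cvec
  split_ifs
  · exact Finsupp.single_eq_of_ne (by simpa using h)
  · rfl

namespace AYPair

variable {cs : CoxeterSystem M W} {F : Type*} [Field F] {K : Set W}

theorem coeffAt_simple_Cvec (P : AYPair cs F K) (i : B) {w : W} (hw : w ∈ K) (u : W) :
    coeffAt (P.ρ (cs.simple i) (Cvec F K w hw)) u =
      P.a i u * coeffAt (Cvec F K w hw) u +
        P.b i (u * cs.simple i) * coeffAt (Cvec F K w hw) (u * cs.simple i) := by
  have hne : w * cs.simple i ≠ w := by
    intro h
    have h1 : cs.simple i = 1 := mul_eq_left.mp h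
    have h2 := cs.length_simple i
    simp [h1] at h2
  have key : coeffAt (P.ρ (cs.simple i) (Cvec F K w hw)) u =
      P.a i w * coeffAt (Cvec F K w hw) u +
        P.b i w * coeffAt (Cvec F K w hw) (u * cs.simple i) := by
    by_cases h : w * cs.simple i ∈ K
    · rw [P.axiomA_mem i w hw h, coeffAt_add, coeffAt_smul, coeffAt_smul]
      by_cases hu : u = w * cs.simple i
      · subst hu
        simp [coeffAt_Cvec_self]
      · have hu' : u * cs.simple i ≠ w := by
          rintro rfl
          simp at hu
        rw [coeffAt_Cvec_of_ne h hu, coeffAt_Cvec_of_ne hw hu']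
    · rw [P.axiomA_not_mem i w hw h, coeffAt_smul, P.b_eq_zero i w hw h]
      ring
  rw [key]
  congr 1
  · by_cases hu : u = w
    · rw [hu]
    · simp [coeffAt_Cvec_of_ne hw hu]
  · by_cases hu : u * cs.simple i = w
    · rw [hu]
    · simp [coeffAt_Cvec_of_ne hw hu]

theorem coeffAt_simple (P : AYPair cs F K) (i : B) (x : ↥K →₀ F) (u : W) :
    coeffAt (P.ρ (cs.simple i) x) u =
      P.a i u * coeffAt x u + P.b i (u * cs.simple i) * coeffAt x (u * cs.simple i) := by
  induction x using Finsupp.induction_linear with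
  | zero => simp [coeffAt]
  | add f g hf hg =>
    rw [map_add, coeffAt_add, hf, hg, coeffAt_add, coeffAt_add]
    ring
  | single k c =>
    have hk : Finsupp.single k c = c • Cvec F K k.1 k.2 := by simp [Cvec]
    rw [hk, map_smul, coeffAt_smul, coeffAt_simple_Cvec, coeffAt_smul, coeffAt_smul]
    ring

/-- The coefficient of `C_{vg}` in `ρ(g⁻¹) C_v`. It is the product of the `b`-coefficients along
any reduced path from `v` to `vg`. -/
noncomputable def leadingCoeff (P : AYPair cs F K) {v : W} (hv : v ∈ K) (g : W) : F :=
  coeffAt (P.ρ g⁻¹ (Cvec F K v hv)) (v * g)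

theorem rho_inv_mul_simple (P : AYPair cs F K) (g : W) (i : B) (x : ↥K →₀ F) :
    P.ρ (g * cs.simple i)⁻¹ x = P.ρ (cs.simple i) (P.ρ g⁻¹ x) := by
  rw [mul_inv_rev, cs.inv_simple, map_mul]
  rfl

theorem coeffAt_rho_inv_eq_zero (P : AYPair cs F K) {v : W} (hv : v ∈ K) (g : W) :
    ∀ y : W, y ≠ g → cs.length g ≤ cs.length y →
      coeffAt (P.ρ g⁻¹ (Cvec F K v hv)) (v * y) = 0 := by
  induction hn : cs.length g generalizing g with
  | zero =>
    intro y hy _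
    obtain rfl := cs.length_eq_zero_iff.mp hn
    simpa using coeffAt_Cvec_of_ne hv (u := v * y) (by simpa using hy)
  | succ n ih =>
    intro y hy hle
    have hg : g ≠ 1 := by
      rintro rfl
      simp at hn
    obtain ⟨i, hi⟩ := cs.exists_rightDescent_of_ne_one hg
    obtain ⟨h, rfl⟩ : ∃ h, g = h * cs.simple i := ⟨g * cs.simple i, by simp⟩
    have hlen := cs.isRightDescent_iff.mp hi
    simp only [cs.simple_mul_simple_cancel_right] at hlen
    have hhn : cs.length h = n := by omega
    have hys : n ≤ cs.length (y * cs.simple i) := by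
      rcases cs.length_mul_simple y i with h' | h' <;> omega
    rw [rho_inv_mul_simple, coeffAt_simple, mul_assoc v, ih h hhn y, ih h hhn _ _ hys]
    · simp
    · rintro rfl
      simp at hy
    · rintro rfl
      omega
    · omega

theorem leadingCoeff_mul_simple (P : AYPair cs F K) {v : W} (hv : v ∈ K) (g : W) (i : B)
    (h : cs.length g < cs.length (g * cs.simple i)) :
    P.leadingCoeff hv (g * cs.simple i) = P.leadingCoeff hv g * P.b i (v * g) := by
  have hne : g * cs.simple i ≠ g := fun h' => by simp [h'] at h
  rw [leadingCoeff, rho_inv_mul_simple, coeffAt_simple,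
    coeffAt_rho_inv_eq_zero P hv g _ hne h.le, mul_assoc v, cs.simple_mul_simple_cancel_right,
    leadingCoeff]
  ring

theorem leadingCoeff_one (P : AYPair cs F K) {v : W} (hv : v ∈ K) :
    P.leadingCoeff hv 1 = 1 := by
  simp [leadingCoeff, coeffAt_Cvec_self]

theorem leadingCoeff_mul_simple_ne_zero (P : AYPair cs F K) {v : W} (hv : v ∈ K) (g : W) (i : B)
    (hg : P.leadingCoeff hv g ≠ 0) (hb : P.b i (v * g) ≠ 0) :
    P.leadingCoeff hv (g * cs.simple i) ≠ 0 := by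
  rcases cs.length_mul_simple g i with h | h
  · rw [leadingCoeff_mul_simple P hv g i (by omega)]
    exact mul_ne_zero hg hb
  · have := leadingCoeff_mul_simple P hv (g * cs.simple i) i
      (by rw [cs.simple_mul_simple_cancel_right]; omega)
    rw [cs.simple_mul_simple_cancel_right] at this
    exact left_ne_zero_of_mul (this ▸ hg)

/-- A coordinate subspace is invariant once its index set is closed under feasible arcs. -/
theorem spanOf_invariant (P : AYPair cs F K) {K' : Set W}
    (hcl : ∀ i : B, ∀ w ∈ K', w * cs.simple i ∈ K → P.b i w ≠ 0 → w * cs.simple i ∈ K')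
    (g : W) (x : ↥K →₀ F) (hx : x ∈ spanOf F K K') : P.ρ g x ∈ spanOf F K K' := by
  induction g using cs.simple_induction generalizing x with
  | simple i =>
    refine Submodule.span_induction ?_ ?_ ?_ ?_ hx
    · rintro _ ⟨w, hw, hw', rfl⟩
      have hCw : Cvec F K w hw ∈ spanOf F K K' := Submodule.subset_span ⟨w, hw, hw', rfl⟩
      by_cases h : w * cs.simple i ∈ K
      · rw [P.axiomA_mem i w hw h]
        refine add_mem (Submodule.smul_mem _ _ hCw) ?_
        by_cases hb : P.b i w = 0
        · simp [hb]
        · exact Submodule.smul_mem _ _ (Submodule.subset_span ⟨_, h, hcl i w hw' h hb, rfl⟩)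
      · rw [P.axiomA_not_mem i w hw h]
        exact Submodule.smul_mem _ _ hCw
    · simp
    · intro x y _ _ hx hy
      rw [map_add]
      exact add_mem hx hy
    · intro c x _ hx
      rw [map_smul]
      exact Submodule.smul_mem _ _ hx
  | one => simpa using hx
  | mul g h hg hh =>
    rw [map_mul]
    exact hg _ (hh _ hx)

end AYPair

/-- in a minimal AY pair, `b_s(w) ≠ 0` whenever `w ∈ K` and `ws ∈ K`. -/
theorem stmt3 (cs : CoxeterSystem M W) (F : Type*) [Field F] (K : Set W)
    (P : AYPair cs F K) (hmin : P.Minimal)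
    (i : B) (w : W) (hw : w ∈ K) (hws : w * cs.simple i ∈ K) :
    P.b i w ≠ 0 := by
  let K' : Set W := {u | u ∈ K ∧ P.leadingCoeff hw (w⁻¹ * u) ≠ 0}
  have hK' : K' = K := by
    refine hmin.2 K' (fun u hu => hu.1) ⟨w, hw, ?_⟩ (P.spanOf_invariant ?_)
    · simp [AYPair.leadingCoeff_one]
    · rintro j u ⟨_, hu⟩ hus hb
      refine ⟨hus, ?_⟩
      rw [← mul_assoc]
      exact P.leadingCoeff_mul_simple_ne_zero hw _ j hu (by simpa using hb)
  have hmem : w * cs.simple i ∈ K' := hK' ▸ hws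
  have hcoeff := P.leadingCoeff_mul_simple hw 1 i (by simp)
  rw [one_mul, AYPair.leadingCoeff_one, one_mul, mul_one] at hcoeff
  rw [← hcoeff]
  simpa using hmem.2
end

section
/- Let K be a convex subset of W containing the identity element, and let ρ : S → End_F(V_K) be a map satisfying Axiom (B) together with the involution relations ρ_s² = 1 for all s ∈ S, and assume ȧ_t ≠ 0, ḃ_t ≠ 0, b̈_t ≠ 0 for all t ∈ T_K. Let s,t ∈ S with m(s,t) = 3. Then ρ_sρ_tρ_s = ρ_tρ_sρ_t if and only if both of the following hold: (a) for every w ∈ K with ℓ(w) < ℓ(ws), ℓ(w) < ℓ(wt), and such that ws ∈ K or wt ∈ K: 1/ȧ_{wstsw⁻¹} = 1/ȧ_{wsw⁻¹} + 1/ȧ_{wtw⁻¹}; (b) for every w ∈ K with ws ∉ K and wt ∉ K: ȧ_{wsw⁻¹} = ȧ_{wtw⁻¹} ∈ {1,−1}. -/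
open CoxeterSystem

variable {B W : Type*} [Group W] {M : CoxeterMatrix B}

/-- `T_K`: reflections of the form `w s w⁻¹` with `w ∈ K` and `ws ∈ K`. -/
def TK (cs : CoxeterSystem M W) (K : Set W) : Set W :=
  {t | ∃ (i : B) (w : W), w ∈ K ∧ w * cs.simple i ∈ K ∧ t = w * cs.simple i * w⁻¹}

/-- `T_∂K`: reflections of the form `w s w⁻¹` with `w ∈ K` and `ws ∉ K`. -/
def TbK (cs : CoxeterSystem M W) (K : Set W) : Set W :=
  {t | ∃ (i : B) (w : W), w ∈ K ∧ w * cs.simple i ∉ K ∧ t = w * cs.simple i * w⁻¹}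

/-- A map `ρ : S → End_F(V_K)` satisfying Axiom (B), together with its coefficient data
`ȧ, ä, ḃ, b̈` (functions of the reflection `w s w⁻¹`). -/
structure AxiomBMap (cs : CoxeterSystem M W) (F : Type*) [Field F] (K : Set W) where
  ρ : B → Module.End F (↥K →₀ F)
  ad : W → F  -- ȧ
  aBar : W → F  -- ä
  bd : W → F  -- ḃ
  bBar : W → F  -- b̈
  axiomB_lt_mem : ∀ (i : B) (w : W) (hw : w ∈ K) (h : w * cs.simple i ∈ K),
    cs.length w < cs.length (w * cs.simple i) →
    ρ i (Cvec F K w hw) = ad (w * cs.simple i * w⁻¹) • Cvec F K w hw +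
      bd (w * cs.simple i * w⁻¹) • Cvec F K (w * cs.simple i) h
  axiomB_lt_not_mem : ∀ (i : B) (w : W) (hw : w ∈ K), w * cs.simple i ∉ K →
    cs.length w < cs.length (w * cs.simple i) →
    ρ i (Cvec F K w hw) = ad (w * cs.simple i * w⁻¹) • Cvec F K w hw
  axiomB_gt_mem : ∀ (i : B) (w : W) (hw : w ∈ K) (h : w * cs.simple i ∈ K),
    cs.length (w * cs.simple i) < cs.length w →
    ρ i (Cvec F K w hw) = aBar (w * cs.simple i * w⁻¹) • Cvec F K w hw +
      bBar (w * cs.simple i * w⁻¹) • Cvec F K (w * cs.simple i) h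
  axiomB_gt_not_mem : ∀ (i : B) (w : W) (hw : w ∈ K), w * cs.simple i ∉ K →
    cs.length (w * cs.simple i) < cs.length w →
    ρ i (Cvec F K w hw) = aBar (w * cs.simple i * w⁻¹) • Cvec F K w hw
  bd_eq_zero : ∀ (i : B) (w : W), w ∈ K → w * cs.simple i ∉ K →
    cs.length w < cs.length (w * cs.simple i) → bd (w * cs.simple i * w⁻¹) = 0
  bBar_eq_zero : ∀ (i : B) (w : W), w ∈ K → w * cs.simple i ∉ K →
    cs.length (w * cs.simple i) < cs.length w → bBar (w * cs.simple i * w⁻¹) = 0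

/-- A subset `K` of `W` is convex in the right Cayley graph: for all `x, y ∈ K`,
every geodesic from `x` to `y` has all of its vertices in `K`. -/
def IsConvex (cs : CoxeterSystem M W) (K : Set W) : Prop :=
  ∀ x ∈ K, ∀ y ∈ K, ∀ l : List B, x * cs.wordProd l = y →
    l.length = cs.length (x⁻¹ * y) →
    ∀ n ≤ l.length, x * cs.wordProd (l.take n) ∈ K

/-- The linear form `2 B(e_i, ·)` of the geometric representation of a Coxeter system. -/
noncomputable def coxeterForm (M : CoxeterMatrix B) (i : B) : Module.Dual ℝ (B →₀ ℝ) :=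
  Finsupp.linearCombination ℝ fun j => -(2 * Real.cos (Real.pi / M i j))

theorem coxeterForm_single (M : CoxeterMatrix B) (i j : B) :
    coxeterForm M i (Finsupp.single j 1) = -(2 * Real.cos (Real.pi / M i j)) := by
  simp [coxeterForm]

theorem coxeterForm_self (M : CoxeterMatrix B) (i : B) :
    coxeterForm M i (Finsupp.single i 1) = 2 := by
  simp [coxeterForm_single]

/-- The reflection in the `i`-th simple root of the geometric representation. -/
noncomputable def coxeterReflection (M : CoxeterMatrix B) (i : B) :
    (B →₀ ℝ) ≃ₗ[ℝ] (B →₀ ℝ) :=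
  Module.reflection (coxeterForm_self M i)

theorem isLiftable_coxeterReflection (M : CoxeterMatrix B) :
    M.IsLiftable (coxeterReflection M) := by
  intro i j
  rcases eq_or_ne i j with rfl | hij
  · rw [M.diagonal, pow_one]
    ext1 z
    exact Module.involutive_reflection (coxeterForm_self M i) z
  have h1 : M i j ≠ 1 := M.off_diagonal i j hij
  obtain ⟨m, hm⟩ : ∃ m, M i j = m := ⟨_, rfl⟩
  have hm' : M j i = m := by rw [M.symmetric, hm]
  rw [hm] at h1 ⊢
  ext1 z
  rcases Nat.eq_zero_or_pos m with rfl | hpos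
  · simp
  have hf : coxeterForm M i (Finsupp.single j 1) = -(2 * Real.cos (Real.pi / m)) := by
    rw [coxeterForm_single, hm]
  have hg : coxeterForm M j (Finsupp.single i 1) = -(2 * Real.cos (Real.pi / m)) := by
    rw [coxeterForm_single, hm']
  have ht : 2 * Real.cos (2 * (Real.pi / m)) =
      coxeterForm M i (Finsupp.single j 1) * coxeterForm M j (Finsupp.single i 1) - 2 := by
    rw [hf, hg, Real.cos_two_mul]; ring
  have key := Module.reflection_mul_reflection_pow_apply
    (coxeterForm_self M i) (coxeterForm_self M j) m z _ ht
  change ((coxeterReflection M i * coxeterReflection M j) ^ m) z = z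
  refine key.trans ?_
  rcases eq_or_ne m 2 with rfl | h2
  · have h0 : Real.cos (Real.pi / (2 : ℕ)) = 0 := by simp
    have e1 : (((2 : ℕ) : ℤ) - 1) / 2 = 0 := by norm_num
    have e2 : (((2 : ℕ) : ℤ) - 2) / 2 = 0 := by norm_num
    have e3 : (((2 : ℕ) : ℤ) - 3) / 2 = -1 := by norm_num
    have e4 : ((2 : ℕ) : ℤ) / 2 = 1 := by norm_num
    rw [e1, e2, e3, e4, hf, hg, h0]
    simp [Real.cos_two_mul]
    norm_num
    abel
  have hm3 : 3 ≤ m := by omega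
  have hmR : (3 : ℝ) ≤ m := by exact_mod_cast hm3
  have hsin : Real.sin (2 * (Real.pi / m)) ≠ 0 := by
    refine (Real.sin_pos_of_pos_of_lt_pi ?_ ?_).ne'
    · positivity
    · rw [← mul_div_assoc, div_lt_iff₀ (by positivity)]
      nlinarith [Real.pi_pos]
  have hS (n : ℤ) := Polynomial.Chebyshev.S_two_mul_real_cos (2 * (Real.pi / m)) n
  rcases Nat.even_or_odd' m with ⟨k, hk | hk⟩
  · have hkR : (m : ℝ) = 2 * k := by exact_mod_cast hk
    have hk0 : (k : ℝ) ≠ 0 := by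
      intro h; rw [h] at hkR; linarith
    have e1 : ((m : ℤ) - 1) / 2 = k - 1 := by omega
    have e2 : ((m : ℤ) - 2) / 2 = k - 1 := by omega
    have hz : (Polynomial.Chebyshev.S ℝ ((k : ℤ) - 1)).eval
        (2 * Real.cos (2 * (Real.pi / m))) = 0 := by
      have h := hS (k - 1)
      have : (((k : ℤ) - 1 : ℤ) + 1 : ℝ) * (2 * (Real.pi / m)) = Real.pi := by
        rw [hkR]; push_cast; field_simp; ring
      rw [this, Real.sin_pi] at h
      exact (mul_eq_zero.mp h).resolve_right hsin
    rw [e1, e2, hz]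
    simp
  · have hkR : (m : ℝ) = 2 * k + 1 := by exact_mod_cast hk
    have e1 : ((m : ℤ) - 1) / 2 = k := by omega
    have e2 : ((m : ℤ) - 2) / 2 = k - 1 := by omega
    have e3 : ((m : ℤ) - 3) / 2 = k - 1 := by omega
    have e4 : (m : ℤ) / 2 = k := by omega
    have hz : (Polynomial.Chebyshev.S ℝ (k : ℤ)).eval (2 * Real.cos (2 * (Real.pi / m))) +
        (Polynomial.Chebyshev.S ℝ ((k : ℤ) - 1)).eval
          (2 * Real.cos (2 * (Real.pi / m))) = 0 := by
      have h := hS k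
      have h' := hS (k - 1)
      have hang : (((k : ℤ) - 1 : ℤ) + 1 : ℝ) * (2 * (Real.pi / m)) =
          2 * Real.pi - ((k : ℤ) + 1 : ℝ) * (2 * (Real.pi / m)) := by
        have : (m : ℝ) ≠ 0 := by linarith
        field_simp
        rw [hkR]; push_cast; ring
      rw [hang, Real.sin_two_pi_sub, ← h] at h'
      refine (mul_eq_zero.mp ?_).resolve_right hsin
      linear_combination h'
    rw [e1, e2, e3, e4, hz]
    simp

theorem simple_ne_of_eq_three (cs : CoxeterSystem M W) {i j : B}
    (hm : M i j = 3) : cs.simple i ≠ cs.simple j := by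
  intro h
  have hij : i ≠ j := by
    rintro rfl
    simp at hm
  have h' := congrArg (cs.lift ⟨_, isLiftable_coxeterReflection M⟩) h
  rw [lift_apply_simple, lift_apply_simple] at h'
  have h2 := congrArg (fun φ => φ (Finsupp.single j 1) j) h'
  simp [coxeterReflection, Module.reflection_apply, coxeterForm_single, hm, hij] at h2
  norm_num at h2

open Classical in
/-- The action of a simple reflection on `W × ℤ/2` from which the parity of the number of
occurrences of an element in a right inversion sequence is read off. -/
noncomputable def signedConj (cs : CoxeterSystem M W) (i : B) : Function.End (W × ZMod 2) :=
  fun p => (cs.simple i * p.1 * cs.simple i, p.2 + if p.1 = cs.simple i then 1 else 0)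

theorem isLiftable_signedConj (cs : CoxeterSystem M W) : M.IsLiftable (signedConj cs) := by
  classical
  intro i j
  set c : W := cs.simple i * cs.simple j with hc
  have hcinv : c⁻¹ = cs.simple j * cs.simple i := by simp [hc]
  have hconj (n : ℕ) : c ^ n * cs.simple j = cs.simple j * (c⁻¹) ^ n := by
    induction n with
    | zero => simp
    | succ n ih =>
      rw [pow_succ', pow_succ', mul_assoc, ih, hcinv, hc]
      simp only [mul_assoc]
      simp
  have hconj' (n : ℕ) : (c⁻¹) ^ n * cs.simple j = cs.simple j * c ^ n := by
    have h := hconj n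
    rw [inv_pow] at h ⊢
    rw [inv_mul_eq_iff_eq_mul, ← mul_assoc, h, mul_assoc, inv_mul_cancel, mul_one]
  let h : W → ℕ → ZMod 2 := fun t n => if t = (c⁻¹) ^ n * cs.simple j then 1 else 0
  have key (l : ℕ) (t : W) (ε : ZMod 2) :
      ((signedConj cs i * signedConj cs j) ^ l) (t, ε) =
        (c ^ l * t * (c⁻¹) ^ l, ε + ∑ n ∈ Finset.range (2 * l), h t n) := by
    induction l with
    | zero =>
      simp only [pow_zero, one_mul, mul_one, mul_zero, Finset.range_zero, Finset.sum_empty,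
        add_zero]
      rfl
    | succ l ih =>
      have e0 : (c ^ l * t * (c⁻¹) ^ l = cs.simple j) ↔ t = (c⁻¹) ^ (2 * l) * cs.simple j := by
        rw [two_mul, pow_add, mul_assoc (c⁻¹ ^ l), hconj', inv_pow, mul_inv_eq_iff_eq_mul,
          ← eq_inv_mul_iff_mul_eq]
      have e1 : (cs.simple j * (c ^ l * t * (c⁻¹) ^ l) * cs.simple j = cs.simple i) ↔
          t = (c⁻¹) ^ (2 * l + 1) * cs.simple j := by
        have : (c⁻¹) ^ (2 * l + 1) * cs.simple j =
            (c⁻¹) ^ l * (cs.simple j * cs.simple i * cs.simple j) * c ^ l := by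
          rw [show 2 * l + 1 = l + 1 + l by ring, pow_add, mul_assoc, hconj', pow_succ,
            ← mul_assoc]
          simp only [hcinv, mul_assoc]
        rw [this]
        constructor
        · intro H
          rw [← H]
          simp [mul_assoc]
        · rintro rfl
          simp [mul_assoc]
      rw [pow_succ', show 2 * (l + 1) = 2 * l + 1 + 1 by ring, Finset.sum_range_succ,
        Finset.sum_range_succ]
      change signedConj cs i (signedConj cs j (((signedConj cs i * signedConj cs j) ^ l) (t, ε))) = _
      rw [ih]
      simp only [signedConj, e0, e1, h]
      refine Prod.ext ?_ ?_
      · have hr : c⁻¹ ^ (l + 1) = c⁻¹ ^ l * (cs.simple j * cs.simple i) := by rw [pow_succ, hcinv]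
        have hl : c ^ (l + 1) = cs.simple i * cs.simple j * c ^ l := pow_succ' c l
        simp only [hr, hl, mul_assoc]
      · simp only [add_assoc]
  have hper : c ^ M i j = 1 := cs.simple_mul_simple_pow i j
  funext ⟨t, ε⟩
  rw [key, inv_pow, hper, two_mul, Finset.sum_range_add]
  have : ∀ n, h t (M i j + n) = h t n := by
    intro n
    simp only [h, pow_add, inv_pow, hper, one_mul]
  simp only [this, CharTwo.add_self_eq_zero, add_zero, inv_one, mul_one,
    one_mul]
  rfl

/-- The parity of the number of occurrences of `t` in the right inversion sequence of any word
representing `w`. -/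
noncomputable def inversionParity (cs : CoxeterSystem M W) (w t : W) : ZMod 2 :=
  (cs.lift ⟨_, isLiftable_signedConj cs⟩ w (t, 0)).2

theorem lift_signedConj_apply (cs : CoxeterSystem M W) (w t : W) (ε : ZMod 2) :
    cs.lift ⟨_, isLiftable_signedConj cs⟩ w (t, ε) =
      (w * t * w⁻¹, ε + inversionParity cs w t) := by
  suffices h : ∀ ε, ∃ δ, ∀ ε', cs.lift ⟨_, isLiftable_signedConj cs⟩ w (t, ε + ε') =
      (w * t * w⁻¹, ε + ε' + δ) by
    obtain ⟨δ, hδ⟩ := h 0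
    have h0 := hδ 0
    have h1 := hδ ε
    simp only [zero_add] at h0 h1
    rw [h1, inversionParity, h0]
  induction w using cs.simple_induction_left with
  | one =>
    intro ε
    refine ⟨0, fun ε' => ?_⟩
    rw [map_one, one_mul, inv_one, mul_one, add_zero]
    rfl
  | mul_simple_left w i ih =>
    intro ε
    obtain ⟨δ, hδ⟩ := ih ε
    refine ⟨δ + (signedConj cs i (w * t * w⁻¹, 0)).2, fun ε' => ?_⟩
    rw [map_mul, lift_apply_simple]
    change signedConj cs i (cs.lift ⟨_, isLiftable_signedConj cs⟩ w (t, ε + ε')) = _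
    rw [hδ]
    simp [signedConj, mul_assoc, add_assoc]

theorem inversionParity_mul (cs : CoxeterSystem M W) (x y t : W) :
    inversionParity cs (x * y) t =
      inversionParity cs y t + inversionParity cs x (y * t * y⁻¹) := by
  rw [inversionParity, map_mul]
  change (cs.lift ⟨_, isLiftable_signedConj cs⟩ x
    (cs.lift ⟨_, isLiftable_signedConj cs⟩ y (t, 0))).2 = _
  rw [lift_signedConj_apply, lift_signedConj_apply, zero_add]

open Classical in
theorem inversionParity_simple (cs : CoxeterSystem M W) (i : B) (t : W) :
    inversionParity cs (cs.simple i) t = if t = cs.simple i then 1 else 0 := by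
  rw [inversionParity, lift_apply_simple, signedConj, zero_add]

theorem mem_rightInvSeq_of_inversionParity_ne_zero (cs : CoxeterSystem M W) (ω : List B) (t : W)
    (h : inversionParity cs (cs.wordProd ω) t ≠ 0) : t ∈ cs.rightInvSeq ω := by
  classical
  induction ω with
  | nil =>
    refine absurd ?_ h
    rw [wordProd_nil, inversionParity, map_one]
    rfl
  | cons i ω ih =>
    rw [wordProd_cons, inversionParity_mul, inversionParity_simple] at h
    rw [rightInvSeq, List.mem_cons]
    by_cases h1 : inversionParity cs (cs.wordProd ω) t = 0
    · left
      rw [h1, zero_add, ite_ne_right_iff] at h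
      rw [← h.1]
      group
    · exact Or.inr (ih h1)

theorem length_mul_lt_of_inversionParity_ne_zero (cs : CoxeterSystem M W) {w t : W}
    (h : inversionParity cs w t ≠ 0) : cs.length (w * t) < cs.length w := by
  obtain ⟨ω, hω, rfl⟩ := cs.exists_isReduced w
  exact (cs.isRightInversion_of_mem_rightInvSeq hω
    (mem_rightInvSeq_of_inversionParity_ne_zero cs ω t h)).2

theorem inversionParity_mul_simple_self (cs : CoxeterSystem M W) (w : W) (i : B) :
    inversionParity cs (w * cs.simple i) (cs.simple i) =
      1 + inversionParity cs w (cs.simple i) := by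
  rw [inversionParity_mul, inversionParity_simple]
  simp

theorem inversionParity_simple_eq_zero_iff (cs : CoxeterSystem M W) (w : W) (i : B) :
    inversionParity cs w (cs.simple i) = 0 ↔ cs.length w < cs.length (w * cs.simple i) := by
  constructor
  · intro h
    have := length_mul_lt_of_inversionParity_ne_zero cs (w := w * cs.simple i) (t := cs.simple i)
      (by rw [inversionParity_mul_simple_self, h]; decide)
    simpa using this
  · intro h
    by_contra h'
    exact absurd (length_mul_lt_of_inversionParity_ne_zero cs h') (by omega)

theorem braid_of_eq_three (cs : CoxeterSystem M W) {i j : B} (hm : M i j = 3) :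
    cs.simple i * cs.simple j * cs.simple i = cs.simple j * cs.simple i * cs.simple j := by
  have h := cs.simple_mul_simple_pow i j
  rw [hm, pow_succ, pow_two] at h
  have h' := eq_inv_of_mul_eq_one_left
    (a := cs.simple i * cs.simple j * cs.simple i)
    (b := cs.simple j * cs.simple i * cs.simple j) (by simpa only [mul_assoc] using h)
  rw [h']
  simp [mul_assoc]


theorem mul_braid_of_eq_three (cs : CoxeterSystem M W) {i j : B} (hm : M i j = 3) (w : W) :
    w * cs.simple i * cs.simple j * cs.simple i = w * cs.simple j * cs.simple i * cs.simple j := by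
  simpa only [mul_assoc] using congrArg (w * ·) (braid_of_eq_three cs hm)

theorem conj_mul_simple (cs : CoxeterSystem M W) (w : W) (i j : B) :
    w * cs.simple i * cs.simple j * (w * cs.simple i)⁻¹ =
      w * cs.simple i * cs.simple j * cs.simple i * w⁻¹ := by
  rw [mul_inv_rev, inv_simple, mul_assoc _ (cs.simple i) w⁻¹]

theorem length_lt_mul_mul_simple_of_eq_three (cs : CoxeterSystem M W) {i j : B} (hm : M i j = 3)
    {w : W} (hj : cs.length w < cs.length (w * cs.simple j)) :
    cs.length (w * cs.simple i * cs.simple j) <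
      cs.length (w * cs.simple i * cs.simple j * cs.simple i) := by
  rw [← inversionParity_simple_eq_zero_iff] at hj ⊢
  have hne := simple_ne_of_eq_three cs hm
  have hb := braid_of_eq_three cs hm
  have e1 : cs.simple j * cs.simple i * (cs.simple j)⁻¹ ≠ cs.simple i := by
    intro h
    rw [inv_simple, ← hb, mul_eq_right] at h
    exact hne (by rw [← cs.inv_simple j]; exact eq_inv_of_mul_eq_one_left h)
  have e2 : cs.simple i * (cs.simple j * cs.simple i * (cs.simple j)⁻¹) * (cs.simple i)⁻¹ =
      cs.simple j := by
    rw [inv_simple, inv_simple, ← hb]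
    simp [mul_assoc]
  rw [inversionParity_mul, inversionParity_mul, inversionParity_simple, inversionParity_simple,
    if_neg hne, if_neg e1, e2, hj]
  simp

theorem length_lt_mul_simple_of_eq_three (cs : CoxeterSystem M W) {i j : B} (hm : M i j = 3)
    {w : W} (hi : cs.length w < cs.length (w * cs.simple i))
    (hj : cs.length w < cs.length (w * cs.simple j)) :
    cs.length (w * cs.simple i) < cs.length (w * cs.simple i * cs.simple j) := by
  have h3 := length_lt_mul_mul_simple_of_eq_three cs hm hj
  have hne := simple_ne_of_eq_three cs hm
  rw [← inversionParity_simple_eq_zero_iff, inversionParity_mul, inversionParity_simple,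
    if_neg hne.symm, zero_add, inv_simple]
  by_contra h
  have h4 := length_mul_lt_of_inversionParity_ne_zero cs h
  rw [← mul_assoc, ← mul_assoc] at h4
  rcases cs.length_mul_simple w i with h5 | h5 <;>
  rcases cs.length_mul_simple (w * cs.simple i) j with h6 | h6 <;> omega

/-- The action of two endomorphisms `S`, `T` along the edges of a hexagon with vertices
`x`, `xs`, `xt`, `xst`, `xts`, `z`, where opposite edges share their coefficients. -/
structure HexagonAction {F V : Type*} [Field F] [AddCommGroup V] [Module F V]
    (S T : Module.End F V) (x xs xt xst xts z : V) (a b c pa pb pc qa qb qc : F) : Prop where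
  S_x : S x = a • x + pa • xs
  S_xs : S xs = -a • xs + qa • x
  T_x : T x = b • x + pb • xt
  T_xt : T xt = -b • xt + qb • x
  T_xs : T xs = c • xs + pc • xst
  T_xst : T xst = -c • xst + qc • xs
  S_xt : S xt = c • xt + pc • xts
  S_xts : S xts = -c • xts + qc • xt
  S_xst : S xst = b • xst + pb • z
  S_z : S z = -b • z + qb • xst
  T_xts : T xts = a • xts + pa • z
  T_z : T z = -a • z + qa • xts

namespace HexagonAction

variable {F V : Type*} [Field F] [AddCommGroup V] [Module F V]
  {S T : Module.End F V} {x xs xt xst xts z : V} {a b c pa pb pc qa qb qc : F}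

theorem symm (H : HexagonAction S T x xs xt xst xts z a b c pa pb pc qa qb qc) :
    HexagonAction T S x xt xs xts xst z b a c pb pa pc qb qa qc :=
  ⟨H.T_x, H.T_xt, H.S_x, H.S_xs, H.S_xt, H.S_xts, H.T_xs, H.T_xst, H.T_xts, H.T_z, H.S_xst, H.S_z⟩

theorem braid_x (H : HexagonAction S T x xs xt xst xts z a b c pa pb pc qa qb qc)
    (ha : pa * qa = 1 - a ^ 2) (hb : pb * qb = 1 - b ^ 2)
    (h : a * b = c * (a + b)) : S (T (S x)) = T (S (T x)) := by
  simp only [H.S_x, H.S_xs, H.T_x, H.T_xt, H.T_xs, H.S_xt, H.S_xst, H.T_xts, map_add,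
    map_smul]
  match_scalars <;> grind

theorem braid_xs (H : HexagonAction S T x xs xt xst xts z a b c pa pb pc qa qb qc)
    (ha : pa * qa = 1 - a ^ 2) (hc : pc * qc = 1 - c ^ 2)
    (h : a * b = c * (a + b)) : S (T (S xs)) = T (S (T xs)) := by
  simp only [H.S_x, H.S_xs, H.T_x, H.T_xs, H.T_xst, H.S_xt, H.S_xst, H.T_z, map_add,
    map_smul]
  match_scalars <;> grind

theorem braid_xst (H : HexagonAction S T x xs xt xst xts z a b c pa pb pc qa qb qc)
    (hb : pb * qb = 1 - b ^ 2) (hc : pc * qc = 1 - c ^ 2)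
    (h : a * b = c * (a + b)) : S (T (S xst)) = T (S (T xst)) := by
  simp only [H.S_xs, H.T_x, H.T_xs, H.T_xst, H.S_xts, H.S_xst, H.S_z, H.T_z, map_add,
    map_smul]
  match_scalars <;> grind

theorem braid_z (H : HexagonAction S T x xs xt xst xts z a b c pa pb pc qa qb qc)
    (ha : pa * qa = 1 - a ^ 2) (hb : pb * qb = 1 - b ^ 2)
    (h : a * b = c * (a + b)) : S (T (S z)) = T (S (T z)) := by
  simp only [H.S_xs, H.T_xt, H.T_xst, H.S_xts, H.S_xst, H.S_z, H.T_xts, H.T_z, map_add,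
    map_smul]
  match_scalars <;> grind

theorem coeff_of_braid_x (H : HexagonAction S T x xs xt xst xts z a b c pa pb pc qa qb qc)
    (hpa : pa ≠ 0) (φ : V →ₗ[F] F) (hx : φ x = 0) (hxs : φ xs = 1) (hxt : φ xt = 0)
    (hxst : φ xst = 0) (hxts : φ xts = 0) (hz : φ z = 0)
    (h : S (T (S x)) = T (S (T x))) : a * b = c * (a + b) := by
  have h' := congrArg φ h
  simp only [H.S_x, H.S_xs, H.T_x, H.T_xt, H.T_xs, H.S_xt, H.S_xst, H.T_xts, map_add,
    map_smul, hx, hxs, hxt, hxst, hxts, hz, smul_eq_mul] at h'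
  apply mul_left_cancel₀ hpa
  linear_combination h'

end HexagonAction

theorem IsConvex.mem_of_length_lt {cs : CoxeterSystem M W} {K : Set W} (hK : IsConvex cs K)
    (h1 : (1 : W) ∈ K) {x : W} {i : B} (hx : cs.length x < cs.length (x * cs.simple i))
    (hxi : x * cs.simple i ∈ K) : x ∈ K := by
  obtain ⟨ω, hω, rfl⟩ := cs.exists_isReduced x
  have := hK 1 h1 _ hxi (ω ++ [i]) (by simp [wordProd_append])
    (by
      rcases cs.length_mul_simple (cs.wordProd ω) i with h | h
      · simp [h, hω.eq]
      · omega) ω.length (by simp)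
  simpa using this

theorem IsConvex.length_lt_of_not_mem {cs : CoxeterSystem M W} {K : Set W} (hK : IsConvex cs K)
    (h1 : (1 : W) ∈ K) {x : W} {i : B} (hx : x ∈ K) (hxi : x * cs.simple i ∉ K) :
    cs.length x < cs.length (x * cs.simple i) := by
  by_contra h
  have hlt := lt_of_le_of_ne (not_lt.mp h) (cs.length_mul_simple_ne x i)
  exact hxi (hK.mem_of_length_lt h1 (i := i) (by simpa using hlt) (by simpa using hx))

open Classical in
/-- The basis vector `C_x`, extended by zero to indices outside `K`. -/
noncomputable def cvecExt {X : Type*} (F : Type*) [Field F] (K : Set X) (x : X) : ↥K →₀ F :=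
  if h : x ∈ K then Cvec F K x h else 0

theorem cvecExt_of_mem {X : Type*} (F : Type*) [Field F] {K : Set X} {x : X} (h : x ∈ K) :
    cvecExt F K x = Cvec F K x h := dif_pos h

theorem cvecExt_of_not_mem {X : Type*} (F : Type*) [Field F] {K : Set X} {x : X} (h : x ∉ K) :
    cvecExt F K x = 0 := dif_neg h

theorem cvecExt_apply_self {X : Type*} (F : Type*) [Field F] {K : Set X} {x : X} (h : x ∈ K) :
    cvecExt F K x ⟨x, h⟩ = 1 := by
  rw [cvecExt_of_mem F h, Cvec, Finsupp.single_eq_same]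

theorem cvecExt_apply_of_ne {X : Type*} (F : Type*) [Field F] {K : Set X} {x y : X}
    (hy : y ∈ K) (hxy : x ≠ y) : cvecExt F K x ⟨y, hy⟩ = 0 := by
  by_cases h : x ∈ K
  · rw [cvecExt_of_mem F h, Cvec, Finsupp.single_eq_of_ne]
    simpa using hxy.symm
  · rw [cvecExt_of_not_mem F h, Finsupp.zero_apply]

namespace AxiomBMap

variable {cs : CoxeterSystem M W} {F : Type*} [Field F] {K : Set W} (P : AxiomBMap cs F K)

open Classical in
/-- The coefficient `b̈_r`, set to zero outside `T_K`. -/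
noncomputable def bBarIn (r : W) : F := if r ∈ TK cs K then P.bBar r else 0

variable {P}

theorem notMem_TK (hbd : ∀ t ∈ TK cs K, P.bd t ≠ 0) {x : W} {i : B} (hx : x ∈ K)
    (hxi : x * cs.simple i ∉ K) (hlt : cs.length x < cs.length (x * cs.simple i)) :
    x * cs.simple i * x⁻¹ ∉ TK cs K :=
  fun h => hbd _ h (P.bd_eq_zero i x hx hxi hlt)

theorem rho_up (hK : IsConvex cs K) (h1 : (1 : W) ∈ K) {x : W} {i : B}
    (hlt : cs.length x < cs.length (x * cs.simple i)) :
    P.ρ i (cvecExt F K x) = P.ad (x * cs.simple i * x⁻¹) • cvecExt F K x +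
      P.bd (x * cs.simple i * x⁻¹) • cvecExt F K (x * cs.simple i) := by
  by_cases hx : x ∈ K
  · by_cases hxi : x * cs.simple i ∈ K
    · rw [cvecExt_of_mem F hx, cvecExt_of_mem F hxi]
      exact P.axiomB_lt_mem i x hx hxi hlt
    · rw [cvecExt_of_mem F hx, cvecExt_of_not_mem F hxi, smul_zero, add_zero]
      exact P.axiomB_lt_not_mem i x hx hxi hlt
  · have hxi : x * cs.simple i ∉ K := fun h => hx (hK.mem_of_length_lt h1 hlt h)
    simp [cvecExt_of_not_mem F hx, cvecExt_of_not_mem F hxi]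

theorem rho_down_of_mem {x : W} {i : B} (hx : x ∈ K) (hxi : x * cs.simple i ∈ K)
    (hlt : cs.length x < cs.length (x * cs.simple i)) :
    P.ρ i (cvecExt F K (x * cs.simple i)) =
      P.aBar (x * cs.simple i * x⁻¹) • cvecExt F K (x * cs.simple i) +
        P.bBar (x * cs.simple i * x⁻¹) • cvecExt F K x := by
  have e : x * cs.simple i * cs.simple i = x := by simp
  have e' : x * cs.simple i * cs.simple i * (x * cs.simple i)⁻¹ = x * cs.simple i * x⁻¹ := by
    simp [mul_assoc]
  have hx' : x * cs.simple i * cs.simple i ∈ K := by rwa [e]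
  have h := P.axiomB_gt_mem i (x * cs.simple i) hxi hx' (by rwa [e])
  rw [e'] at h
  rwa [← cvecExt_of_mem F hxi, ← cvecExt_of_mem F hx', e] at h

theorem rho_rho (hinv : ∀ i : B, P.ρ i * P.ρ i = 1) (i : B) (v : ↥K →₀ F) :
    P.ρ i (P.ρ i v) = v := by
  simpa using congrArg (fun f => f v) (hinv i)

theorem coeff_of_mem (hK : IsConvex cs K) (h1 : (1 : W) ∈ K)
    (hinv : ∀ i : B, P.ρ i * P.ρ i = 1) {x : W} {i : B} (hx : x ∈ K)
    (hxi : x * cs.simple i ∈ K) (hlt : cs.length x < cs.length (x * cs.simple i)) :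
    P.bd (x * cs.simple i * x⁻¹) * P.bBar (x * cs.simple i * x⁻¹) =
        1 - P.ad (x * cs.simple i * x⁻¹) ^ 2 ∧
      P.bd (x * cs.simple i * x⁻¹) *
        (P.ad (x * cs.simple i * x⁻¹) + P.aBar (x * cs.simple i * x⁻¹)) = 0 := by
  have h := rho_rho hinv i (cvecExt F K x)
  have hne : x ≠ x * cs.simple i := fun h => by rw [← h] at hlt; exact lt_irrefl _ hlt
  rw [rho_up hK h1 hlt, map_add, map_smul, map_smul, rho_up hK h1 hlt,
    rho_down_of_mem hx hxi hlt] at h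
  have h2 := DFunLike.congr_fun h ⟨x, hx⟩
  have h3 := DFunLike.congr_fun h ⟨x * cs.simple i, hxi⟩
  simp only [Finsupp.add_apply, Finsupp.smul_apply, smul_eq_mul, cvecExt_apply_self,
    cvecExt_apply_of_ne F hx hne.symm, cvecExt_apply_of_ne F hxi hne] at h2 h3
  constructor
  · linear_combination h2
  · linear_combination h3

theorem rho_down (hK : IsConvex cs K) (h1 : (1 : W) ∈ K)
    (hinv : ∀ i : B, P.ρ i * P.ρ i = 1) (hbd : ∀ t ∈ TK cs K, P.bd t ≠ 0) {x : W} {i : B}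
    (hlt : cs.length x < cs.length (x * cs.simple i)) :
    P.ρ i (cvecExt F K (x * cs.simple i)) =
      -P.ad (x * cs.simple i * x⁻¹) • cvecExt F K (x * cs.simple i) +
        P.bBarIn (x * cs.simple i * x⁻¹) • cvecExt F K x := by
  by_cases hx : x ∈ K
  · by_cases hxi : x * cs.simple i ∈ K
    · have hr : x * cs.simple i * x⁻¹ ∈ TK cs K := ⟨i, x, hx, hxi, rfl⟩
      have h := (mul_eq_zero.mp (coeff_of_mem hK h1 hinv hx hxi hlt).2).resolve_left (hbd _ hr)
      rw [rho_down_of_mem hx hxi hlt, bBarIn, if_pos hr, eq_neg_of_add_eq_zero_right h]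
    · rw [cvecExt_of_not_mem F hxi, bBarIn, if_neg (notMem_TK hbd hx hxi hlt)]
      simp
  · have hxi : x * cs.simple i ∉ K := fun h => hx (hK.mem_of_length_lt h1 hlt h)
    simp [cvecExt_of_not_mem F hx, cvecExt_of_not_mem F hxi]

theorem rho_eq_smul (hK : IsConvex cs K) (h1 : (1 : W) ∈ K) {x : W} {i : B} (hx : x ∈ K)
    (hxi : x * cs.simple i ∉ K) :
    P.ρ i (cvecExt F K x) = P.ad (x * cs.simple i * x⁻¹) • cvecExt F K x := by
  rw [rho_up hK h1 (hK.length_lt_of_not_mem h1 hx hxi), cvecExt_of_not_mem F hxi, smul_zero,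
    add_zero]

theorem ad_sq_of_not_mem (hK : IsConvex cs K) (h1 : (1 : W) ∈ K)
    (hinv : ∀ i : B, P.ρ i * P.ρ i = 1) {x : W} {i : B} (hx : x ∈ K)
    (hxi : x * cs.simple i ∉ K) : P.ad (x * cs.simple i * x⁻¹) ^ 2 = 1 := by
  have h := rho_rho hinv i (cvecExt F K x)
  rw [rho_eq_smul hK h1 hx hxi, map_smul, rho_eq_smul hK h1 hx hxi] at h
  have h2 := DFunLike.congr_fun h ⟨x, hx⟩
  simp only [Finsupp.smul_apply, smul_eq_mul, cvecExt_apply_self] at h2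
  linear_combination h2

theorem coeff_eq (hK : IsConvex cs K) (h1 : (1 : W) ∈ K)
    (hinv : ∀ i : B, P.ρ i * P.ρ i = 1) (had : ∀ t ∈ TK cs K, P.ad t ≠ 0) {x : W} {i : B}
    (hx : x ∈ K) (hlt : cs.length x < cs.length (x * cs.simple i)) :
    P.bd (x * cs.simple i * x⁻¹) * P.bBarIn (x * cs.simple i * x⁻¹) =
        1 - P.ad (x * cs.simple i * x⁻¹) ^ 2 ∧ P.ad (x * cs.simple i * x⁻¹) ≠ 0 := by
  by_cases hxi : x * cs.simple i ∈ K
  · have hr : x * cs.simple i * x⁻¹ ∈ TK cs K := ⟨i, x, hx, hxi, rfl⟩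
    rw [bBarIn, if_pos hr]
    exact ⟨(coeff_of_mem hK h1 hinv hx hxi hlt).1, had _ hr⟩
  · have h := ad_sq_of_not_mem hK h1 hinv hx hxi
    rw [P.bd_eq_zero i x hx hxi hlt, h]
    refine ⟨by simp, fun h0 => ?_⟩
    rw [h0] at h
    simp at h

theorem coeff_eq_third (hK : IsConvex cs K) (h1 : (1 : W) ∈ K)
    (hinv : ∀ i : B, P.ρ i * P.ρ i = 1) (had : ∀ t ∈ TK cs K, P.ad t ≠ 0) {i j : B}
    (hm : M i j = 3) {w : W} (hi : cs.length w < cs.length (w * cs.simple i))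
    (hj : cs.length w < cs.length (w * cs.simple j))
    (hw : w * cs.simple i ∈ K ∨ w * cs.simple j ∈ K) :
    P.bd (w * cs.simple i * cs.simple j * cs.simple i * w⁻¹) *
          P.bBarIn (w * cs.simple i * cs.simple j * cs.simple i * w⁻¹) =
        1 - P.ad (w * cs.simple i * cs.simple j * cs.simple i * w⁻¹) ^ 2 ∧
      P.ad (w * cs.simple i * cs.simple j * cs.simple i * w⁻¹) ≠ 0 := by
  rcases hw with hw | hw
  · have h := coeff_eq (P := P) hK h1 hinv had hw (length_lt_mul_simple_of_eq_three cs hm hi hj)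
    rwa [conj_mul_simple] at h
  · have h := coeff_eq (P := P) hK h1 hinv had hw
      (length_lt_mul_simple_of_eq_three cs (M.symmetric i j ▸ hm) hj hi)
    rwa [conj_mul_simple, ← mul_braid_of_eq_three cs hm] at h

theorem hexagonAction (hK : IsConvex cs K) (h1 : (1 : W) ∈ K)
    (hinv : ∀ i : B, P.ρ i * P.ρ i = 1) (hbd : ∀ t ∈ TK cs K, P.bd t ≠ 0) {i j : B}
    (hm : M i j = 3) {w : W} (hi : cs.length w < cs.length (w * cs.simple i))
    (hj : cs.length w < cs.length (w * cs.simple j)) :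
    HexagonAction (P.ρ i) (P.ρ j) (cvecExt F K w) (cvecExt F K (w * cs.simple i))
      (cvecExt F K (w * cs.simple j)) (cvecExt F K (w * cs.simple i * cs.simple j))
      (cvecExt F K (w * cs.simple j * cs.simple i))
      (cvecExt F K (w * cs.simple i * cs.simple j * cs.simple i))
      (P.ad (w * cs.simple i * w⁻¹)) (P.ad (w * cs.simple j * w⁻¹))
      (P.ad (w * cs.simple i * cs.simple j * cs.simple i * w⁻¹))
      (P.bd (w * cs.simple i * w⁻¹)) (P.bd (w * cs.simple j * w⁻¹))
      (P.bd (w * cs.simple i * cs.simple j * cs.simple i * w⁻¹))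
      (P.bBarIn (w * cs.simple i * w⁻¹)) (P.bBarIn (w * cs.simple j * w⁻¹))
      (P.bBarIn (w * cs.simple i * cs.simple j * cs.simple i * w⁻¹)) := by
  have hm' : M j i = 3 := by rw [M.symmetric, hm]
  have hb := mul_braid_of_eq_three cs hm w
  have lij := length_lt_mul_simple_of_eq_three cs hm hi hj
  have lji := length_lt_mul_simple_of_eq_three cs hm' hj hi
  have liji := length_lt_mul_mul_simple_of_eq_three cs hm hj
  have ljij := length_lt_mul_mul_simple_of_eq_three cs hm' hi
  have ciji : w * cs.simple i * cs.simple j * cs.simple i * (w * cs.simple i * cs.simple j)⁻¹ =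
      w * cs.simple j * w⁻¹ := by
    rw [hb]; simp [mul_assoc]
  have cjij : w * cs.simple j * cs.simple i * cs.simple j * (w * cs.simple j * cs.simple i)⁻¹ =
      w * cs.simple i * w⁻¹ := by
    rw [← hb]; simp [mul_assoc]
  have uij := rho_up (P := P) hK h1 lij
  have uji := rho_up (P := P) hK h1 lji
  have uiji := rho_up (P := P) hK h1 liji
  have ujij := rho_up (P := P) hK h1 ljij
  have dij := rho_down hK h1 hinv hbd lij
  have dji := rho_down hK h1 hinv hbd lji
  have diji := rho_down hK h1 hinv hbd liji
  have djij := rho_down hK h1 hinv hbd ljij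
  rw [conj_mul_simple] at uij dij
  rw [conj_mul_simple, ← hb] at uji dji
  rw [ciji] at uiji diji
  rw [cjij, ← hb] at ujij djij
  exact ⟨rho_up hK h1 hi, rho_down hK h1 hinv hbd hi, rho_up hK h1 hj,
    rho_down hK h1 hinv hbd hj, uij, dij, uji, dji, uiji, diji, ujij, djij⟩

theorem ad_relation_of_braid (hK : IsConvex cs K) (h1 : (1 : W) ∈ K)
    (hinv : ∀ i : B, P.ρ i * P.ρ i = 1) (hbd : ∀ t ∈ TK cs K, P.bd t ≠ 0) {i j : B}
    (hm : M i j = 3) (hbraid : P.ρ i * P.ρ j * P.ρ i = P.ρ j * P.ρ i * P.ρ j) {w : W}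
    (hw : w ∈ K) (hi : cs.length w < cs.length (w * cs.simple i))
    (hj : cs.length w < cs.length (w * cs.simple j)) (hwi : w * cs.simple i ∈ K) :
    P.ad (w * cs.simple i * w⁻¹) * P.ad (w * cs.simple j * w⁻¹) =
      P.ad (w * cs.simple i * cs.simple j * cs.simple i * w⁻¹) *
        (P.ad (w * cs.simple i * w⁻¹) + P.ad (w * cs.simple j * w⁻¹)) := by
  have H := hexagonAction (P := P) hK h1 hinv hbd hm hi hj
  have hne := simple_ne_of_eq_three cs hm
  have hm' : M j i = 3 := by rw [M.symmetric, hm]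
  have lij := length_lt_mul_simple_of_eq_three cs hm hi hj
  have lji := length_lt_mul_simple_of_eq_three cs hm' hj hi
  have liji := length_lt_mul_mul_simple_of_eq_three cs hm hj
  refine H.coeff_of_braid_x (hbd _ ⟨i, w, hw, hwi, rfl⟩)
    (Finsupp.lapply ⟨w * cs.simple i, hwi⟩) ?_ (cvecExt_apply_self F hwi) ?_ ?_ ?_ ?_
    (by simpa using congrArg (fun f => f (cvecExt F K w)) hbraid)
  · exact cvecExt_apply_of_ne F hwi fun h => by rw [← h] at hi; omega
  · exact cvecExt_apply_of_ne F hwi fun h => hne (mul_left_cancel h).symm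
  · exact cvecExt_apply_of_ne F hwi fun h => by rw [h] at lij; omega
  · refine cvecExt_apply_of_ne F hwi fun h => ?_
    rw [h] at lji
    have := cs.length_mul_simple w i
    have := cs.length_mul_simple w j
    omega
  · exact cvecExt_apply_of_ne F hwi fun h => by rw [h] at liji; omega

theorem braid_apply (hK : IsConvex cs K) (h1 : (1 : W) ∈ K)
    (hinv : ∀ i : B, P.ρ i * P.ρ i = 1) (had : ∀ t ∈ TK cs K, P.ad t ≠ 0)
    (hbd : ∀ t ∈ TK cs K, P.bd t ≠ 0) {i j : B} (hm : M i j = 3) {w : W} (hw : w ∈ K)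
    (hi : cs.length w < cs.length (w * cs.simple i))
    (hj : cs.length w < cs.length (w * cs.simple j))
    (hwij : w * cs.simple i ∈ K ∨ w * cs.simple j ∈ K)
    (h : P.ad (w * cs.simple i * w⁻¹) * P.ad (w * cs.simple j * w⁻¹) =
      P.ad (w * cs.simple i * cs.simple j * cs.simple i * w⁻¹) *
        (P.ad (w * cs.simple i * w⁻¹) + P.ad (w * cs.simple j * w⁻¹))) {y : W}
    (hy : y ∈ ({w, w * cs.simple i, w * cs.simple j, w * cs.simple i * cs.simple j,
      w * cs.simple j * cs.simple i, w * cs.simple i * cs.simple j * cs.simple i} : Set W)) :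
    P.ρ i (P.ρ j (P.ρ i (cvecExt F K y))) = P.ρ j (P.ρ i (P.ρ j (cvecExt F K y))) := by
  have H := hexagonAction (P := P) hK h1 hinv hbd hm hi hj
  have ha := (coeff_eq (P := P) hK h1 hinv had hw hi).1
  have hb := (coeff_eq (P := P) hK h1 hinv had hw hj).1
  have hc := (coeff_eq_third (P := P) hK h1 hinv had hm hi hj hwij).1
  have h' := h
  rw [mul_comm, add_comm] at h'
  rcases hy with rfl | rfl | rfl | rfl | rfl | rfl
  · exact H.braid_x ha hb h
  · exact H.braid_xs ha hc h
  · exact (H.symm.braid_xs hb hc h').symm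
  · exact H.braid_xst hb hc h
  · exact (H.symm.braid_xst ha hc h').symm
  · exact H.braid_z ha hb h

end AxiomBMap

theorem mul_simple_mem_hexagon_of_eq_three (cs : CoxeterSystem M W) {i j : B} (hm : M i j = 3)
    {w y : W} (hy : y ∈ ({w, w * cs.simple i, w * cs.simple j, w * cs.simple i * cs.simple j,
      w * cs.simple j * cs.simple i, w * cs.simple i * cs.simple j * cs.simple i} : Set W)) :
    y * cs.simple i ∈ ({w, w * cs.simple i, w * cs.simple j, w * cs.simple i * cs.simple j,
      w * cs.simple j * cs.simple i, w * cs.simple i * cs.simple j * cs.simple i} : Set W) ∧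
      y * cs.simple j ∈ ({w, w * cs.simple i, w * cs.simple j, w * cs.simple i * cs.simple j,
      w * cs.simple j * cs.simple i, w * cs.simple i * cs.simple j * cs.simple i} : Set W) := by
  have hb := mul_braid_of_eq_three cs hm w
  simp only [Set.mem_insert_iff, Set.mem_singleton_iff] at hy ⊢
  rcases hy with rfl | rfl | rfl | rfl | rfl | rfl
  · simp
  · simp
  · simp
  · simp
  · simp [hb]
  · constructor
    · simp
    · simp [hb]

theorem IsConvex.exists_minimal_of_eq_three {cs : CoxeterSystem M W} {K : Set W}
    (hK : IsConvex cs K) (h1 : (1 : W) ∈ K) {i j : B} (hm : M i j = 3) (x : W) (hx : x ∈ K) :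
    ∃ w ∈ K, cs.length w < cs.length (w * cs.simple i) ∧
      cs.length w < cs.length (w * cs.simple j) ∧
      x ∈ ({w, w * cs.simple i, w * cs.simple j, w * cs.simple i * cs.simple j,
        w * cs.simple j * cs.simple i, w * cs.simple i * cs.simple j * cs.simple i} : Set W) := by
  induction hn : cs.length x using Nat.strong_induction_on generalizing x with
  | _ n ih =>
    have down (k : B) (hk : ¬ cs.length x < cs.length (x * cs.simple k)) :
        cs.length (x * cs.simple k) < n ∧ x * cs.simple k ∈ K := by
      have hlt : cs.length (x * cs.simple k) < cs.length x :=
        lt_of_le_of_ne (not_lt.mp hk) (cs.length_mul_simple_ne x k)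
      exact ⟨hn ▸ hlt, hK.mem_of_length_lt h1 (i := k) (by simpa using hlt) (by simpa using hx)⟩
    by_cases hi : cs.length x < cs.length (x * cs.simple i)
    · by_cases hj : cs.length x < cs.length (x * cs.simple j)
      · exact ⟨x, hx, hi, hj, by simp⟩
      · obtain ⟨hlt, hmem⟩ := down j hj
        obtain ⟨w, hw, hwi, hwj, hxw⟩ := ih _ hlt _ hmem rfl
        exact ⟨w, hw, hwi, hwj,
          by
          simpa only [simple_mul_simple_cancel_right] using
            (mul_simple_mem_hexagon_of_eq_three cs hm hxw).2⟩
    · obtain ⟨hlt, hmem⟩ := down i hi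
      obtain ⟨w, hw, hwi, hwj, hxw⟩ := ih _ hlt _ hmem rfl
      exact ⟨w, hw, hwi, hwj,
        by
          simpa only [simple_mul_simple_cancel_right] using
            (mul_simple_mem_hexagon_of_eq_three cs hm hxw).1⟩

theorem inv_eq_inv_add_inv_iff {F : Type*} [Field F] {a b c : F} (ha : a ≠ 0) (hb : b ≠ 0)
    (hc : c ≠ 0) : c⁻¹ = a⁻¹ + b⁻¹ ↔ a * b = c * (a + b) := by
  field_simp
  rw [add_comm b a]

/-- for a convex `K` containing the identity, a map satisfying Axiom (B)
and the involution relations, with the stated nonvanishing, and `m(s,t) = 3`, the braid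
relation `ρ_s ρ_t ρ_s = ρ_t ρ_s ρ_t` holds iff conditions (a) and (b) hold. -/
theorem stmt11 (cs : CoxeterSystem M W) (F : Type*) [Field F] (K : Set W)
    (hKconv : IsConvex cs K) (h1K : (1 : W) ∈ K)
    (P : AxiomBMap cs F K)
    (hinv : ∀ i : B, P.ρ i * P.ρ i = 1)
    (had : ∀ t ∈ TK cs K, P.ad t ≠ 0)
    (hbd : ∀ t ∈ TK cs K, P.bd t ≠ 0) (hbBar : ∀ t ∈ TK cs K, P.bBar t ≠ 0)
    (i j : B) (hm : M i j = 3) :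
    P.ρ i * P.ρ j * P.ρ i = P.ρ j * P.ρ i * P.ρ j ↔
    ((∀ w ∈ K, cs.length w < cs.length (w * cs.simple i) →
        cs.length w < cs.length (w * cs.simple j) →
        (w * cs.simple i ∈ K ∨ w * cs.simple j ∈ K) →
        (P.ad (w * cs.simple i * cs.simple j * cs.simple i * w⁻¹))⁻¹ =
          (P.ad (w * cs.simple i * w⁻¹))⁻¹ + (P.ad (w * cs.simple j * w⁻¹))⁻¹) ∧
      (∀ w ∈ K, w * cs.simple i ∉ K → w * cs.simple j ∉ K →
        P.ad (w * cs.simple i * w⁻¹) = P.ad (w * cs.simple j * w⁻¹) ∧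
        (P.ad (w * cs.simple i * w⁻¹) = 1 ∨ P.ad (w * cs.simple i * w⁻¹) = -1))) := by
  have hji : M j i = 3 := by rw [M.symmetric, hm]
  constructor
  · intro hbraid
    refine ⟨fun w hw hi hj hwij => ?_, fun w hw hwi hwj => ?_⟩
    · rw [inv_eq_inv_add_inv_iff (AxiomBMap.coeff_eq hKconv h1K hinv had hw hi).2
        (AxiomBMap.coeff_eq hKconv h1K hinv had hw hj).2
        (AxiomBMap.coeff_eq_third hKconv h1K hinv had hm hi hj hwij).2]
      rcases hwij with hwi | hwj
      · exact AxiomBMap.ad_relation_of_braid hKconv h1K hinv hbd hm hbraid hw hi hj hwi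
      · have h := AxiomBMap.ad_relation_of_braid hKconv h1K hinv hbd hji hbraid.symm hw hj hi hwj
        rwa [mul_comm, add_comm, ← mul_braid_of_eq_three cs hm] at h
    · have hi := hKconv.length_lt_of_not_mem h1K hw hwi
      have ha := AxiomBMap.ad_sq_of_not_mem hKconv h1K hinv hw hwi
      have hb := AxiomBMap.ad_sq_of_not_mem hKconv h1K hinv hw hwj
      refine ⟨?_, mul_self_eq_one_iff.mp (by rw [← pow_two, ha])⟩
      have h := congrArg (fun f => f (cvecExt F K w) ⟨w, hw⟩) hbraid
      have hSi := AxiomBMap.rho_eq_smul (P := P) hKconv h1K hw hwi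
      have hSj := AxiomBMap.rho_eq_smul (P := P) hKconv h1K hw hwj
      simp only [Module.End.mul_apply, hSi, hSj, map_smul, Finsupp.smul_apply, smul_eq_mul,
        cvecExt_apply_self] at h
      linear_combination P.ad (w * cs.simple j * w⁻¹) * ha - P.ad (w * cs.simple i * w⁻¹) * hb - h
  · rintro ⟨hA, hB⟩
    refine Finsupp.lhom_ext' fun x => LinearMap.ext_ring ?_
    obtain ⟨x, hx⟩ := x
    suffices h : P.ρ i (P.ρ j (P.ρ i (cvecExt F K x))) =
        P.ρ j (P.ρ i (P.ρ j (cvecExt F K x))) by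
      simpa [cvecExt_of_mem F hx, Cvec] using h
    obtain ⟨w, hw, hi, hj, hxw⟩ := hKconv.exists_minimal_of_eq_three h1K hm x hx
    by_cases hwij : w * cs.simple i ∈ K ∨ w * cs.simple j ∈ K
    · refine AxiomBMap.braid_apply hKconv h1K hinv had hbd hm hw hi hj hwij ?_ hxw
      exact (inv_eq_inv_add_inv_iff (AxiomBMap.coeff_eq hKconv h1K hinv had hw hi).2
        (AxiomBMap.coeff_eq hKconv h1K hinv had hw hj).2
        (AxiomBMap.coeff_eq_third hKconv h1K hinv had hm hi hj hwij).2).mp (hA w hw hi hj hwij)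
    · rw [not_or] at hwij
      obtain ⟨hwi, hwj⟩ := hwij
      have hij := hKconv.mem_of_length_lt h1K (length_lt_mul_simple_of_eq_three cs hm hi hj)
      have hji' := hKconv.mem_of_length_lt h1K (length_lt_mul_simple_of_eq_three cs hji hj hi)
      have hiji := hKconv.mem_of_length_lt h1K (length_lt_mul_mul_simple_of_eq_three cs hm hj)
      have hSi := AxiomBMap.rho_eq_smul (P := P) hKconv h1K hw hwi
      have hSj := AxiomBMap.rho_eq_smul (P := P) hKconv h1K hw hwj
      rcases hxw with rfl | rfl | rfl | rfl | rfl | rfl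
      · simp only [hSi, hSj, map_smul, (hB x hw hwi hwj).1]
      · exact absurd hx hwi
      · exact absurd hx hwj
      · exact absurd (hij hx) hwi
      · exact absurd (hji' hx) hwj
      · exact absurd (hij (hiji hx)) hwi
end
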